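/- There exists a recurrent tableau T ∈ SYT((∞^∞)): a tableau T such that for every m, n ∈ ℕ there exists k ≥ 1 with jdt^k(T)_{i,j} = T_{i,j} for all boxes (i,j) with 1 ≤ i ≤ n and 1 ≤ j ≤ m. (In particular, since no element of SYT((∞^∞)) is periodic, recurrence here is genuinely weaker than periodicity.) -/

import Mathlib

open scoped Classical

/-- A 0-based box `(i, j)` belongs to the infinite shape with `l` rows
(`l = ⊤` gives the shape `(∞^∞)`, `l = (l₀ : ℕ∞)` gives `(∞^l₀)`).
Throughout, boxes are 0-based: the paper's box `(i, j)` (with row `i ≥ 1` and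
column `j ≥ 1`) corresponds to `(i - 1, j - 1)`. -/
def Box (l : ℕ∞) (b : ℕ × ℕ) : Prop := (b.1 : ℕ∞) < l

/-- `T` is an infinite standard Young tableau of the shape given by `Box l`:
entries are positive integers on the shape (and the junk value `0` off the shape),
`T` is a bijection from the boxes of the shape onto the positive integers, and
`T` is strictly increasing along rows and columns. -/
structure IsSYT (l : ℕ∞) (T : ℕ × ℕ → ℕ) : Prop where
  zero_outside : ∀ b : ℕ × ℕ, ¬ Box l b → T b = 0
  pos : ∀ b : ℕ × ℕ, Box l b → 0 < T b
  inj : ∀ b c : ℕ × ℕ, Box l b → Box l c → T b = T c → b = c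
  surj : ∀ n : ℕ, 0 < n → ∃ b : ℕ × ℕ, Box l b ∧ T b = n
  row_lt : ∀ b : ℕ × ℕ, Box l b → T b < T (b.1, b.2 + 1)
  col_lt : ∀ b : ℕ × ℕ, Box l (b.1 + 1, b.2) → T b < T (b.1 + 1, b.2)

/-- The sliding path of the filling `T` inside the set `D` of boxes, started at the
box `c`: at each step the empty box moves to whichever of the boxes directly below
or directly to the right (among those belonging to `D`) carries the smaller entry;
if neither belongs to `D`, the path stays put (it has terminated). -/
noncomputable def slideFrom (D : ℕ × ℕ → Prop) (T : ℕ × ℕ → ℕ) (c : ℕ × ℕ) : ℕ → ℕ × ℕ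
  | 0 => c
  | n + 1 =>
      let b := slideFrom D T c n
      if D (b.1 + 1, b.2) ∧ D (b.1, b.2 + 1) then
        (if T (b.1 + 1, b.2) < T (b.1, b.2 + 1) then (b.1 + 1, b.2) else (b.1, b.2 + 1))
      else if D (b.1 + 1, b.2) then (b.1 + 1, b.2)
      else if D (b.1, b.2 + 1) then (b.1, b.2 + 1)
      else b

/-- The sliding path `p(T)`, 0-indexed: `slide D T n` is the paper's `p_{n+1}(T)`;
it lies on the antidiagonal `i + j = n` as long as the path has not terminated. -/
noncomputable def slide (D : ℕ × ℕ → Prop) (T : ℕ × ℕ → ℕ) : ℕ → ℕ × ℕ :=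
  slideFrom D T (0, 0)

/-- Jeu de taquin on the set of boxes `D`: the entry `1` in the box `(0,0)` is
deleted, entries slide backwards along the sliding path, and every entry is
decremented by `1`.  A box `b` lies on the sliding path iff
`slide D T (b.1 + b.2) = b`; if moreover the path terminates at `b` (which is only
possible for finite tableaux) the box `b` is vacated (junk value `0`). -/
noncomputable def jdt (D : ℕ × ℕ → Prop) (T : ℕ × ℕ → ℕ) : ℕ × ℕ → ℕ := fun b =>
  if slide D T (b.1 + b.2) = b then
    (if slide D T (b.1 + b.2 + 1) = b then 0
     else T (slide D T (b.1 + b.2 + 1)) - 1)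
  else T b - 1


def spr (k : ℕ) : ℕ := if h : k = 0 then 0 else k % 2 + 4 * spr (k / 2)
termination_by k
decreasing_by omega

theorem spr_eq (k : ℕ) : spr k = k % 2 + 4 * spr (k / 2) := by
  by_cases h : k = 0
  · subst h; simp [spr]
  · rw [spr]; simp [h]

theorem spr_lt (b : ℕ) : ∀ a, a < b → spr a < spr b := by
  induction b using Nat.strong_induction_on with
  | _ b ih =>
    intro a hab
    rw [spr_eq a, spr_eq b]
    by_cases h : a / 2 = b / 2
    · rw [h]; omega
    · have := ih (b / 2) (by omega) (a / 2) (by omega)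
      omega

theorem spr_le {a b : ℕ} (h : a ≤ b) : spr a ≤ spr b := by
  rcases h.eq_or_lt with h | h
  · rw [h]
  · exact (spr_lt b a h).le

theorem spr_small (s : ℕ) : ∀ k, k < 2 ^ s → 3 * spr k < 4 ^ s := by
  induction s with
  | zero => intro k hk; have : k = 0 := by simpa using hk
            subst this; simp [spr]
  | succ s ih =>
    intro k hk
    have := ih (k / 2) (by rw [pow_succ] at hk; omega)
    rw [spr_eq, pow_succ]; omega

theorem spr_add (s : ℕ) : ∀ k, k < 2 ^ s → spr (k + 2 ^ s) = spr k + 4 ^ s := by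
  induction s with
  | zero => intro k hk; have : k = 0 := by simpa using hk
            subst this; simp [spr]
  | succ s ih =>
    intro k hk
    rw [pow_succ] at hk
    have := ih (k / 2) (by omega)
    rw [spr_eq, spr_eq k, pow_succ, pow_succ]
    have h2 : (k + 2 ^ s * 2) / 2 = k / 2 + 2 ^ s := by omega
    rw [h2, this]; omega

theorem spr_pow (s : ℕ) : spr (2 ^ s) = 4 ^ s := by
  have := spr_add s 0 (by positivity)
  have h0 : spr 0 = 0 := by simp [spr]
  simpa [h0] using this

def Tz (b : ℕ × ℕ) : ℕ := 2 * spr b.1 + spr b.2 + 1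

theorem spr_inj (i : ℕ) : ∀ j i' j', 2 * spr i + spr j = 2 * spr i' + spr j' →
    i + j ≤ i + j → i = i' ∧ j = j' := by
  suffices H : ∀ N i j i' j', i + j ≤ N → 2 * spr i + spr j = 2 * spr i' + spr j' →
      i = i' ∧ j = j' by
    intro j i' j' h _; exact H _ i j i' j' le_rfl h
  intro N
  induction N using Nat.strong_induction_on with
  | _ N ih =>
    intro i j i' j' hN h
    by_cases h0 : i + j = 0
    · have hi : i = 0 := by omega
      have hj : j = 0 := by omega
      subst hi; subst hj
      have e0 : spr 0 = 0 := by simp [spr]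
      rw [e0] at h
      constructor
      · by_contra hne
        have := spr_lt i' 0 (by omega); omega
      · by_contra hne
        have := spr_lt j' 0 (by omega); omega
    · rw [spr_eq i, spr_eq j, spr_eq i', spr_eq j'] at h
      have := ih (i / 2 + j / 2) (by omega) (i / 2) (j / 2) (i' / 2) (j' / 2) le_rfl (by omega)
      omega

theorem spr_surj (N : ℕ) : ∃ i j, 2 * spr i + spr j = N := by
  induction N using Nat.strong_induction_on with
  | _ N ih =>
    by_cases h : N = 0
    · subst h; exact ⟨0, 0, by simp [spr]⟩
    · obtain ⟨i, j, hij⟩ := ih (N / 4) (by omega)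
      refine ⟨2 * i + (N / 2) % 2, 2 * j + N % 2, ?_⟩
      rw [spr_eq (2 * i + _), spr_eq (2 * j + _)]
      have h1 : (2 * i + (N / 2) % 2) / 2 = i := by omega
      have h2 : (2 * j + N % 2) / 2 = j := by omega
      rw [h1, h2]; omega

theorem box_top (b : ℕ × ℕ) : Box ⊤ b := by
  simp [Box]

theorem Tz_syt : IsSYT ⊤ Tz where
  zero_outside b h := absurd (box_top b) h
  pos b _ := by unfold Tz; omega
  inj b c _ _ h := by
    unfold Tz at h
    have := spr_inj b.1 b.2 c.1 c.2 (by omega) le_rfl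
    exact Prod.ext this.1 this.2
  surj n hn := by
    obtain ⟨i, j, h⟩ := spr_surj (n - 1)
    exact ⟨(i, j), box_top _, by simp only [Tz]; omega⟩
  row_lt b _ := by
    have := spr_lt (b.2 + 1) b.2 (by omega)
    simp only [Tz]; omega
  col_lt b _ := by
    have := spr_lt (b.1 + 1) b.1 (by omega)
    simp only [Tz]; omega

structure JInv (n M e : ℕ) (r : ℕ → ℕ) (U : ℕ × ℕ → ℕ) : Prop where
  anti : ∀ i j, i ≤ j → j < n → r j ≤ r i
  sum : ∑ i ∈ Finset.range n, r i = e
  small : ∀ i j, i < n → j < r i → U (i, j) ≤ e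
  mid : ∀ i j, i < n → j < n → U (i, r i + j) = Tz (i, j) + e
  large : ∀ i j, (n ≤ i ∨ r i + n ≤ j) → e + M < U (i, j)

theorem slide_succ' (U : ℕ × ℕ → ℕ) (k i j : ℕ) (h : slide (Box ⊤) U k = (i, j)) :
    slide (Box ⊤) U (k + 1) = if U (i + 1, j) < U (i, j + 1) then (i + 1, j) else (i, j + 1) := by
  unfold slide at *
  rw [slideFrom]
  simp only [h, box_top, and_self, if_true]

theorem slide_sum (U : ℕ × ℕ → ℕ) (k : ℕ) :
    (slide (Box ⊤) U k).1 + (slide (Box ⊤) U k).2 = k := by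
  induction k with
  | zero => simp [slide, slideFrom]
  | succ k ih =>
    rw [slide_succ' U k (slide (Box ⊤) U k).1 (slide (Box ⊤) U k).2 rfl]
    split_ifs <;> simp only <;> omega

theorem path_ex {n M e : ℕ} {r : ℕ → ℕ} {U : ℕ × ℕ → ℕ} (hT : ∀ i j, i < n → j < n → Tz (i, j) ≤ M)
    (hI : JInv n M e r U) (he : 0 < e) :
    ∃ i, i < n ∧ 0 < r i ∧ (i + 1 < n → r (i + 1) < r i) ∧
      (∀ k, k + 1 ≤ i + r i → (slide (Box ⊤) U k).1 < n ∧
        (slide (Box ⊤) U k).2 < r (slide (Box ⊤) U k).1) ∧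
      (∀ m, m ≤ n → slide (Box ⊤) U (i + (r i - 1) + m) = (i, r i - 1 + m)) ∧
      (∀ k, i + r i + n ≤ k → n ≤ (slide (Box ⊤) U k).1 ∨
        r (slide (Box ⊤) U k).1 + n ≤ (slide (Box ⊤) U k).2) := by
  obtain ⟨anti, sum, small, mid, large⟩ := hI
  have hTpos : ∀ b, 0 < Tz b := fun b => by unfold Tz; omega
  -- non-small entries exceed e
  have nonsmall : ∀ a b, ¬ (a < n ∧ b < r a) → e < U (a, b) := by
    intro a b h
    by_cases ha : n ≤ a
    · have := large a b (Or.inl ha); omega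
    · by_cases hb : r a + n ≤ b
      · have := large a b (Or.inr hb); omega
      · have := mid a (b - r a) (by omega) (by omega)
        have h3 : r a + (b - r a) = b := by omega
        rw [h3] at this
        have := hTpos (a, b - r a); omega
  have hr0 : 0 < n ∧ 0 < r 0 := by
    by_contra hcon
    have : ∑ i ∈ Finset.range n, r i = 0 := by
      apply Finset.sum_eq_zero
      intro i hi
      have hi := Finset.mem_range.1 hi
      have := anti 0 i (by omega) hi
      omega
    omega
  set p := slide (Box ⊤) U with hp
  have hex : ∃ k, ¬ ((p k).1 < n ∧ (p k).2 < r (p k).1) := by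
    refine ⟨n + r 0, fun h => ?_⟩
    have h1 := slide_sum U (n + r 0)
    have h2 := anti 0 (p (n + r 0)).1 (by omega) h.1
    rw [← hp] at h1
    omega
  obtain ⟨K, hK, hmin⟩ : ∃ K, ¬ ((p K).1 < n ∧ (p K).2 < r (p K).1) ∧
      ∀ k < K, ((p k).1 < n ∧ (p k).2 < r (p k).1) :=
    ⟨Nat.find hex, Nat.find_spec hex, fun k hk => not_not.1 (Nat.find_min hex hk)⟩
  have hp0 : p 0 = (0, 0) := by simp [hp, slide, slideFrom]
  have hK0 : K ≠ 0 := by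
    rintro rfl; rw [hp0] at hK; exact hK hr0
  obtain ⟨L, rfl⟩ : ∃ L, K = L + 1 := ⟨K - 1, by omega⟩
  have hL := hmin L (by omega)
  obtain ⟨i, j, hij⟩ : ∃ i j, p L = (i, j) := ⟨_, _, rfl⟩
  have hsum := slide_sum U L
  rw [← hp, hij] at hsum
  rw [hij] at hL
  simp only at hL hsum
  have hstep := slide_succ' U L i j hij
  rw [← hp] at hstep
  have hns : ¬ (i + 1 < n ∧ j < r (i + 1)) ∧ ¬ (i < n ∧ j + 1 < r i) := by
    by_cases h1 : (i + 1 < n ∧ j < r (i + 1))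
    · exfalso
      have a1 := small _ _ h1.1 h1.2
      by_cases h2 : (i < n ∧ j + 1 < r i)
      · rw [hstep] at hK; split_ifs at hK <;> simp only at hK <;> tauto
      · have a2 := nonsmall _ _ h2
        rw [hstep, if_pos (by omega)] at hK
        exact hK h1
    · refine ⟨h1, fun h2 => ?_⟩
      have a1 := small _ _ h2.1 h2.2
      have a2 := nonsmall _ _ h1
      rw [hstep, if_neg (by omega)] at hK
      exact hK h2
  have hjr : j = r i - 1 := by omega
  have hrow : ∀ m, m ≤ n → p (i + (r i - 1) + m) = (i, r i - 1 + m) := by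
    intro m
    induction m with
    | zero => intro _; rw [← hjr, Nat.add_zero, Nat.add_zero, hsum, hij]
    | succ m ih =>
      intro hm
      have h := slide_succ' U _ _ _ (ih (by omega))
      rw [← hp] at h
      rw [← add_assoc, h, if_neg]
      · rfl
      · have h1 := mid i m hL.1 (by omega)
        have e1 : r i - 1 + m + 1 = r i + m := by omega
        rw [e1, h1, not_lt]
        have h2 := hT i m hL.1 (by omega)
        by_cases hn : n ≤ i + 1
        · have := large (i + 1) (r i - 1 + m) (Or.inl hn); omega
        · by_cases hb : r (i + 1) + n ≤ r i - 1 + m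
          · have := large (i + 1) (r i - 1 + m) (Or.inr hb); omega
          · have h3 := mid (i + 1) (r i - 1 + m - r (i + 1)) (by omega) (by omega)
            have e2 : r (i + 1) + (r i - 1 + m - r (i + 1)) = r i - 1 + m := by omega
            rw [e2] at h3
            rw [h3]
            have h4 := spr_le (show i ≤ i + 1 by omega)
            have h5 := spr_le (show m ≤ r i - 1 + m - r (i + 1) by omega)
            simp only [Tz]; omega
  have hlast : ∀ q, n ≤ (p (i + r i + n + q)).1 ∨
        r (p (i + r i + n + q)).1 + n ≤ (p (i + r i + n + q)).2 := by
    intro q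
    induction q with
    | zero =>
      have h := slide_succ' U _ _ _ (hrow n le_rfl)
      rw [← hp] at h
      have e1 : i + r i + n + 0 = i + (r i - 1) + n + 1 := by omega
      rw [e1, h]
      split_ifs
      · simp only; omega
      · simp only; omega
    | succ q ih =>
      have h := slide_succ' U (i + r i + n + q) (p (i + r i + n + q)).1 (p (i + r i + n + q)).2 rfl
      rw [← hp] at h
      rw [← add_assoc, h]
      rcases ih with ih | ih
      · split_ifs <;> simp only <;> omega
      · split_ifs
        · simp only
          by_cases hn : n ≤ (p (i + r i + n + q)).1 + 1
          · left; exact hn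
          · have := anti (p (i + r i + n + q)).1 ((p (i + r i + n + q)).1 + 1) (by omega) (by omega)
            omega
        · simp only; omega
  refine ⟨i, hL.1, by omega, by omega, ?_, hrow, ?_⟩
  · intro k hk; exact hmin k (by omega)
  · intro k hk
    obtain ⟨q, rfl⟩ := Nat.exists_eq_add_of_le hk
    exact hlast q

theorem jdt_eq (U : ℕ × ℕ → ℕ) (b : ℕ × ℕ) : jdt (Box ⊤) U b =
    if slide (Box ⊤) U (b.1 + b.2) = b then U (slide (Box ⊤) U (b.1 + b.2 + 1)) - 1
    else U b - 1 := by
  unfold jdt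
  have h : slide (Box ⊤) U (b.1 + b.2 + 1) ≠ b := by
    intro h
    have := slide_sum U (b.1 + b.2 + 1)
    rw [h] at this; omega
  simp only [h, if_false]

theorem inv_step {n M e : ℕ} {r : ℕ → ℕ} {U : ℕ × ℕ → ℕ}
    (hT : ∀ i j, i < n → j < n → Tz (i, j) ≤ M)
    (hI : JInv n M (e + 1) r U) : ∃ r', JInv n M e r' (jdt (Box ⊤) U) := by
  obtain ⟨i, hi, hri, hcor, hsm, hrow, hlast⟩ := path_ex hT hI (by omega)
  obtain ⟨anti, sum, small, mid, large⟩ := hI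
  have hTpos : ∀ b, 0 < Tz b := fun b => by unfold Tz; omega
  have hri' : Function.update r i (r i - 1) i = r i - 1 := by simp
  have hrne : ∀ a, a ≠ i → Function.update r i (r i - 1) a = r a := fun a ha => by simp [ha]
  -- location of a path cell
  have hrow' : ∀ k, i + r i ≤ k + 1 → k ≤ i + (r i - 1) + n →
      slide (Box ⊤) U k = (i, k - i) := by
    intro k h1 h2
    have := hrow (k - (i + (r i - 1))) (by omega)
    rw [show i + (r i - 1) + (k - (i + (r i - 1))) = k by omega] at this
    rw [this]; congr 1; omega
  refine ⟨Function.update r i (r i - 1), ?_, ?_, ?_, ?_, ?_⟩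
  · intro a b hab hb
    have h0 := anti a b hab hb
    by_cases ha : a = i
    · by_cases hbi : b = i
      · rw [ha, hbi]
      · rw [ha, hri', hrne b hbi]
        have := hcor (by omega)
        have := anti (i + 1) b (by omega) hb
        omega
    · rw [hrne a ha]
      by_cases hbi : b = i
      · rw [hbi, hri']; rw [hbi] at h0; omega
      · rw [hrne b hbi]; exact h0
  · have h1 := Finset.sum_update_of_mem (Finset.mem_range.2 hi) r (r i - 1)
    have h2 := Finset.add_sum_erase (Finset.range n) r (Finset.mem_range.2 hi)
    rw [Finset.sdiff_singleton_eq_erase] at h1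
    rw [h1]; omega
  · intro a b ha hb
    rw [jdt_eq]
    simp only
    have hb' : b < r a := by
      by_cases h : a = i
      · rw [h, hri'] at hb; rw [h]; omega
      · rwa [hrne a h] at hb
    split_ifs with h
    · have hk : a + b + 1 + 1 ≤ i + r i := by
        by_contra hcon
        by_cases hc2 : a + b ≤ i + (r i - 1) + n
        · rw [hrow' (a + b) (by omega) hc2] at h
          have h1 : i = a := congrArg Prod.fst h
          rw [← h1, hri'] at hb
          omega
        · have := hlast (a + b) (by omega)
          rw [h] at this; simp only at this; omega
      have h2 := hsm _ hk
      have := small _ _ h2.1 h2.2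
      simp only [Prod.mk.eta] at this
      omega
    · have := small a b ha hb'; omega
  · intro a b ha hb
    rw [jdt_eq]
    simp only
    by_cases hai : a = i
    · subst hai
      rw [hri', hrow' _ (by omega) (by omega), if_pos (by congr 1; omega),
        hrow' _ (by omega) (by omega)]
      have := mid a b ha hb
      rw [show a + (r a - 1 + b) + 1 - a = r a + b by omega, this]
      omega
    · rw [hrne a hai, if_neg]
      · rw [mid a b ha hb]; omega
      · intro h
        by_cases h1 : a + (r a + b) + 1 ≤ i + r i
        · have := hsm _ h1
          rw [h] at this; simp only at this; omega
        · by_cases h2 : a + (r a + b) ≤ i + (r i - 1) + n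
          · rw [hrow' _ (by omega) h2] at h
            exact hai (congrArg Prod.fst h).symm
          · have := hlast _ (show i + r i + n ≤ a + (r a + b) by omega)
            rw [h] at this; simp only at this; omega
  · intro a b hab
    rw [jdt_eq]
    simp only
    by_cases hcase : n ≤ a ∨ r a + n ≤ b
    · split_ifs with h
      · have hk : i + r i + n ≤ a + b + 1 := by
          by_contra hcon
          by_cases h1 : a + b + 1 ≤ i + r i
          · have := hsm _ h1
            rw [h] at this; simp only at this; omega
          · rw [hrow' _ (by omega) (by omega)] at h
            have h1 : i = a := congrArg Prod.fst h
            subst h1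
            omega
        have := large _ _ (hlast _ hk)
        simp only [Prod.mk.eta] at this
        omega
      · have := large a b hcase; omega
    · have hai : a = i := by
        by_contra hne; rw [hrne a hne] at hab; exact hcase hab
      subst hai
      rw [hri'] at hab
      have hb : b = r a - 1 + n := by omega
      rw [if_pos]
      · have := large _ _ (hlast (a + b + 1) (by omega))
        simp only [Prod.mk.eta] at this
        omega
      · rw [hrow' _ (by omega) (by omega)]; congr 1; omega

theorem inv_iter {n M : ℕ} (hT : ∀ i j, i < n → j < n → Tz (i, j) ≤ M) (e : ℕ) :
    ∀ (r : ℕ → ℕ) (U : ℕ × ℕ → ℕ), JInv n M e r U →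
      ∃ r', JInv n M 0 r' ((jdt (Box ⊤))^[e] U) := by
  induction e with
  | zero => intro r U h; exact ⟨r, h⟩
  | succ e ih =>
    intro r U h
    obtain ⟨r', h'⟩ := inv_step hT h
    rw [Function.iterate_succ_apply]
    exact ih r' _ h'

theorem Tz_le (s i j : ℕ) (hi : i < 2 ^ s) (hj : j < 2 ^ s) : Tz (i, j) ≤ 4 ^ s := by
  have := spr_small s i hi
  have := spr_small s j hj
  simp only [Tz]; omega

theorem inv_init (s : ℕ) : JInv (2 ^ s) (4 ^ s) (4 ^ s) (fun _ => 2 ^ s) Tz where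
  anti _ _ _ _ := le_rfl
  sum := by simp [← mul_pow]
  small i j hi hj := Tz_le s i j hi hj
  mid i j hi hj := by
    simp only [Tz]
    rw [add_comm (2 ^ s) j, spr_add s j hj]; omega
  large i j h := by
    simp only [Tz]
    rcases h with h | h
    · have := spr_le h
      rw [spr_pow] at this; omega
    · have h' : 2 ^ (s + 1) ≤ j := by rw [pow_succ]; omega
      have := spr_le h'
      have h4 : 0 < 4 ^ s := by positivity
      rw [spr_pow, pow_succ] at this; omega

/-- There is a recurrent tableau `T ∈ SYT((∞^∞))`: for every `m, n` there is some
`k ≥ 1` such that `jdt^k(T)` agrees with `T` on all boxes `(i, j)` with `i ≤ n`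
and `j ≤ m` (0-based: `b.1 < n`, `b.2 < m`). -/
theorem stmt_19 :
    ∃ T : ℕ × ℕ → ℕ, IsSYT (⊤ : ℕ∞) T ∧
      ∀ m n : ℕ, ∃ k : ℕ, 1 ≤ k ∧
        ∀ b : ℕ × ℕ, b.1 < n → b.2 < m →
          (jdt (Box (⊤ : ℕ∞)))^[k] T b = T b := by
  refine ⟨Tz, Tz_syt, fun m n => ⟨4 ^ (m + n), Nat.one_le_pow _ _ (by norm_num), ?_⟩⟩
  rintro ⟨i, j⟩ hi hj
  simp only at hi hj
  obtain ⟨r, hr⟩ := inv_iter (Tz_le (m + n)) _ _ _ (inv_init (m + n))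
  have hlt : m + n < 2 ^ (m + n) := Nat.lt_two_pow_self
  have hri : r i = 0 :=
    (Finset.sum_eq_zero_iff.1 hr.sum) i (Finset.mem_range.2 (by omega))
  have := hr.mid i j (by omega) (by omega)
  rwa [hri, Nat.zero_add, Nat.add_zero] at this
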